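/- Let H_E and H_A be Hilbert spaces and, for i = 1,…,d, let Ẽ_i ∈ B(H_E), Ã_i ∈ B(H_A) and X̃_i ∈ B(H_A, H_E), and set E'_i := [[Ẽ_i, X̃_i],[0, Ã_i]] on H_E ⊕ H_A. Then E' = (E'_1,…,E'_d) is a row contraction if and only if Ẽ = (Ẽ_1,…,Ẽ_d) and Ã = (Ã_1,…,Ã_d) are row contractions and there exists a contraction γ : 𝒟_Ã → 𝒟_{*,Ẽ} such that 𝐗̃ = D_{*,Ẽ} ∘ γ ∘ D_Ã as operators H_A^d → H_E (here γ is composed with the inclusion 𝒟_{*,Ẽ} ⊆ H_E, D_Ã is viewed as a map H_A^d → 𝒟_Ã, and 𝐗̃ : H_A^d → H_E is the row operator of (X̃_1,…,X̃_d)). -/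

import Mathlib

noncomputable section

/-- The Hilbert space `ℓ²`-direct sum of `d` copies of `H`. -/
abbrev Hd (d : ℕ) (H : Type*) : Type _ := PiLp 2 fun _ : Fin d => H

/-- The row operator `𝐀 : H^d → K`, `(h_1, …, h_d) ↦ Σ_i A_i h_i`, of a `d`-tuple of
bounded operators `A_i : H → K`. -/
noncomputable def rowOp {d : ℕ} {H K : Type*} [NormedAddCommGroup H] [InnerProductSpace ℂ H]
    [NormedAddCommGroup K] [InnerProductSpace ℂ K] (A : Fin d → (H →L[ℂ] K)) :
    Hd d H →L[ℂ] K :=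
  ∑ i, (A i).comp ((ContinuousLinearMap.proj i).comp
    (PiLp.continuousLinearEquiv 2 ℂ fun _ : Fin d => H).toContinuousLinearMap)

/-- The `i`-th coordinate inclusion `ι_i : H → H^d`. -/
noncomputable def inclPi {d : ℕ} {H : Type*} [NormedAddCommGroup H] [InnerProductSpace ℂ H]
    (i : Fin d) : H →L[ℂ] Hd d H :=
  ((PiLp.continuousLinearEquiv 2 ℂ fun _ : Fin d => H).symm.toContinuousLinearMap).comp
    (ContinuousLinearMap.pi fun j => if j = i then ContinuousLinearMap.id ℂ H else 0)

/-- First coordinate projection of the Hilbert direct sum `H ⊕ K`. -/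
noncomputable def prodFst {H K : Type*} [NormedAddCommGroup H] [InnerProductSpace ℂ H]
    [NormedAddCommGroup K] [InnerProductSpace ℂ K] : WithLp 2 (H × K) →L[ℂ] H :=
  (ContinuousLinearMap.fst ℂ H K).comp (WithLp.prodContinuousLinearEquiv 2 ℂ H K).toContinuousLinearMap

/-- Second coordinate projection of the Hilbert direct sum `H ⊕ K`. -/
noncomputable def prodSnd {H K : Type*} [NormedAddCommGroup H] [InnerProductSpace ℂ H]
    [NormedAddCommGroup K] [InnerProductSpace ℂ K] : WithLp 2 (H × K) →L[ℂ] K :=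
  (ContinuousLinearMap.snd ℂ H K).comp (WithLp.prodContinuousLinearEquiv 2 ℂ H K).toContinuousLinearMap

/-- The `2 × 2` block operator `[[T₁₁, T₁₂], [T₂₁, T₂₂]] : H ⊕ K → H' ⊕ K'`. -/
noncomputable def block2 {H K H' K' : Type*}
    [NormedAddCommGroup H] [InnerProductSpace ℂ H] [NormedAddCommGroup K] [InnerProductSpace ℂ K]
    [NormedAddCommGroup H'] [InnerProductSpace ℂ H'] [NormedAddCommGroup K'] [InnerProductSpace ℂ K']
    (T11 : H →L[ℂ] H') (T12 : K →L[ℂ] H') (T21 : H →L[ℂ] K') (T22 : K →L[ℂ] K') :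
    WithLp 2 (H × K) →L[ℂ] WithLp 2 (H' × K') :=
  ((WithLp.prodContinuousLinearEquiv 2 ℂ H' K').symm.toContinuousLinearMap).comp
    ((T11.comp prodFst + T12.comp prodSnd).prod (T21.comp prodFst + T22.comp prodSnd))

/-- The defect space of a defect operator `D : H → K`: the closure of its range. -/
abbrev defectSpace {H K : Type*} [NormedAddCommGroup H] [InnerProductSpace ℂ H]
    [NormedAddCommGroup K] [InnerProductSpace ℂ K] (D : H →L[ℂ] K) : Submodule ℂ K :=
  (LinearMap.range (D : H →ₗ[ℂ] K)).topologicalClosure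

/-- A defect operator `D : H → K`, viewed as a map into its defect space. -/
noncomputable def toDefect {H K : Type*} [NormedAddCommGroup H] [InnerProductSpace ℂ H]
    [NormedAddCommGroup K] [InnerProductSpace ℂ K] (D : H →L[ℂ] K) : H →L[ℂ] ↥(defectSpace D) :=
  D.codRestrict _ fun x => Submodule.le_topologicalClosure _ (LinearMap.mem_range_self (D : H →ₗ[ℂ] K) x)

/-- The canonical identification `(H ⊕ K)^d ≅ H^d ⊕ K^d`:  from a pair
`(h, k) ∈ H^d ⊕ K^d` form the element of `(H ⊕ K)^d` with `i`-th entry `(h_i, k_i)`. -/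
noncomputable def pairup {d : ℕ} {H K : Type*} [NormedAddCommGroup H] [InnerProductSpace ℂ H]
    [NormedAddCommGroup K] [InnerProductSpace ℂ K] (h : Hd d H) (k : Hd d K) :
    Hd d (WithLp 2 (H × K)) :=
  (WithLp.equiv 2 _).symm fun i =>
    (WithLp.equiv 2 (H × K)).symm ((WithLp.equiv 2 _) h i, (WithLp.equiv 2 _) k i)


/-- A finite `ℓ²`-direct sum of complete spaces is complete. -/
instance PiLp.instCompleteSpaceOfFintype (p : ENNReal) [Fact (1 ≤ p)] {ι : Type*} [Fintype ι]
    (β : ι → Type*) [∀ i, NormedAddCommGroup (β i)] [∀ i, CompleteSpace (β i)] :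
    CompleteSpace (PiLp p β) := by
  have e : PiLp p β ≃ᵤ (∀ i, β i) :=
    { toEquiv := WithLp.equiv p _
      uniformContinuous_toFun := (PiLp.lipschitzWith_ofLp p β).uniformContinuous
      uniformContinuous_invFun := ((PiLp.antilipschitzWith_ofLp p β).to_rightInverse
        (fun _ => rfl)).uniformContinuous }
  exact e.completeSpace_iff.mpr inferInstance


open ContinuousLinearMap in
theorem aux_rowOp_apply {d : ℕ} {H K : Type*} [NormedAddCommGroup H] [InnerProductSpace ℂ H]
    [NormedAddCommGroup K] [InnerProductSpace ℂ K] (A : Fin d → (H →L[ℂ] K)) (x : Hd d H) :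
    rowOp A x = ∑ i, A i (x i) := by
  simp [rowOp]

theorem aux_le_one_iff {H K : Type*} [NormedAddCommGroup H] [InnerProductSpace ℂ H]
    [NormedAddCommGroup K] [InnerProductSpace ℂ K] (T : H →L[ℂ] K) :
    ‖T‖ ≤ 1 ↔ ∀ x, ‖T x‖ ^ 2 ≤ ‖x‖ ^ 2 := by
  constructor
  · intro h x
    have h1 : ‖T x‖ ≤ ‖x‖ := by simpa using T.le_of_opNorm_le h x
    gcongr
  · intro h
    refine T.opNorm_le_bound zero_le_one fun x => ?_
    rw [one_mul]
    exact (sq_le_sq₀ (norm_nonneg _) (norm_nonneg _)).1 (h x)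

theorem aux_block_iff {d : ℕ} {H_E H_A : Type*}
    [NormedAddCommGroup H_E] [InnerProductSpace ℂ H_E]
    [NormedAddCommGroup H_A] [InnerProductSpace ℂ H_A]
    (Et : Fin d → (H_E →L[ℂ] H_E)) (At : Fin d → (H_A →L[ℂ] H_A))
    (Xt : Fin d → (H_A →L[ℂ] H_E))
    (E' : Fin d → (WithLp 2 (H_E × H_A) →L[ℂ] WithLp 2 (H_E × H_A)))
    (hE' : ∀ i, E' i = block2 (Et i) (Xt i) 0 (At i)) :
    ‖rowOp E'‖ ≤ 1 ↔ ∀ h k, ‖rowOp Et h + rowOp Xt k‖ ^ 2 + ‖rowOp At k‖ ^ 2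
      ≤ ‖h‖ ^ 2 + ‖k‖ ^ 2 := by
  have key : ∀ z : Hd d (WithLp 2 (H_E × H_A)), ∀ h k, (∀ i, (z i).fst = h i) →
      (∀ i, (z i).snd = k i) →
      ‖rowOp E' z‖ ^ 2 = ‖rowOp Et h + rowOp Xt k‖ ^ 2 + ‖rowOp At k‖ ^ 2 ∧
      ‖z‖ ^ 2 = ‖h‖ ^ 2 + ‖k‖ ^ 2 := by
    intro z h k hh hk
    constructor
    · have hz : rowOp E' z = WithLp.toLp 2 (rowOp Et h + rowOp Xt k, rowOp At k) := by
        simp only [aux_rowOp_apply, hE', ← Finset.sum_add_distrib]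
        have : ∀ i, block2 (Et i) (Xt i) 0 (At i) (z i)
            = (WithLp.prodContinuousLinearEquiv 2 ℂ H_E H_A).symm
              (Et i (h i) + Xt i (k i), At i (k i)) := by
          intro i
          simp [block2, prodFst, prodSnd, ← hh, ← hk]
        simp only [this]
        rw [← map_sum]
        refine congrArg (WithLp.toLp 2) ?_
        simp [Prod.ext_iff, Prod.fst_sum, Prod.snd_sum]
      rw [hz, WithLp.prod_norm_sq_eq_of_L2]
      rfl
    · simp only [PiLp.norm_sq_eq_of_L2, ← Finset.sum_add_distrib, ← hh, ← hk,
        WithLp.prod_norm_sq_eq_of_L2]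
  rw [aux_le_one_iff]
  constructor
  · intro H h k
    obtain ⟨h1, h2⟩ := key (WithLp.toLp 2 fun i => WithLp.toLp 2 (h i, k i)) h k
      (fun i => rfl) (fun i => rfl)
    rw [← h1, ← h2]
    exact H _
  · intro H z
    obtain ⟨h1, h2⟩ := key z (WithLp.toLp 2 fun i => (z i).fst) (WithLp.toLp 2 fun i => (z i).snd)
      (fun i => rfl) (fun i => rfl)
    rw [h1, h2]
    exact H _ _

theorem aux_norm_sq_D {H K : Type*} [NormedAddCommGroup H] [InnerProductSpace ℂ H] [CompleteSpace H]
    [NormedAddCommGroup K] [InnerProductSpace ℂ K] [CompleteSpace K]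
    (T : H →L[ℂ] K) (D : H →L[ℂ] H) (hD : D.IsPositive)
    (h2 : D.comp D = 1 - (ContinuousLinearMap.adjoint T).comp T) (x : H) :
    ‖D x‖ ^ 2 = ‖x‖ ^ 2 - ‖T x‖ ^ 2 := by
  have h3 : D (D x) = x - ContinuousLinearMap.adjoint T (T x) := by
    have := congrArg (fun S : H →L[ℂ] H => S x) h2
    simpa using this
  have h4 : inner ℂ (D x) (D x) = inner ℂ x x - inner ℂ (T x) (T x) := by
    rw [hD.inner_left_eq_inner_right, h3, inner_sub_right, ContinuousLinearMap.adjoint_inner_right]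
  simp only [inner_self_eq_norm_sq_to_K] at h4
  exact_mod_cast h4

theorem aux_exists_D {H K : Type*} [NormedAddCommGroup H] [InnerProductSpace ℂ H] [CompleteSpace H]
    [NormedAddCommGroup K] [InnerProductSpace ℂ K] [CompleteSpace K]
    (T : H →L[ℂ] K) (hT : ‖T‖ ≤ 1) : ∃ D : H →L[ℂ] H, D.IsPositive ∧
      D.comp D = 1 - (ContinuousLinearMap.adjoint T).comp T := by
  have hp : (1 - (ContinuousLinearMap.adjoint T).comp T).IsPositive := by
    rw [ContinuousLinearMap.isPositive_def']
    refine ⟨(ContinuousLinearMap.isPositive_one.isSelfAdjoint).sub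
      (ContinuousLinearMap.isPositive_adjoint_comp_self T).isSelfAdjoint, fun x => ?_⟩
    have h := (aux_le_one_iff T).1 hT x
    rw [ContinuousLinearMap.reApplyInnerSelf_apply]
    simp only [ContinuousLinearMap.sub_apply, ContinuousLinearMap.one_apply,
      ContinuousLinearMap.comp_apply, inner_sub_left, ContinuousLinearMap.adjoint_inner_left,
      map_sub, inner_self_eq_norm_sq]
    linarith
  have h0 := (ContinuousLinearMap.nonneg_iff_isPositive _).2 hp
  exact ⟨CFC.sqrt _, (ContinuousLinearMap.nonneg_iff_isPositive _).1 (CFC.sqrt_nonneg _),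
    CFC.sqrt_mul_sqrt_self _ h0⟩

theorem aux_dense {H K : Type*} [NormedAddCommGroup H] [InnerProductSpace ℂ H]
    [NormedAddCommGroup K] [InnerProductSpace ℂ K] (D : H →L[ℂ] K) : DenseRange (toDefect D) := by
  intro y
  rw [closure_subtype]
  have h := y.2
  rw [← SetLike.mem_coe, Submodule.topologicalClosure_coe] at h
  convert h using 2
  ext z
  constructor
  · rintro ⟨_, ⟨x, rfl⟩, rfl⟩
    exact ⟨x, rfl⟩
  · rintro ⟨x, rfl⟩
    exact ⟨_, ⟨x, rfl⟩, rfl⟩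

/-- Factorization of a form dominated by two dense-range maps. -/
theorem aux_factor {H K G L : Type*} [NormedAddCommGroup H] [InnerProductSpace ℂ H]
    [NormedAddCommGroup K] [InnerProductSpace ℂ K]
    [NormedAddCommGroup G] [InnerProductSpace ℂ G]
    [NormedAddCommGroup L] [InnerProductSpace ℂ L] [CompleteSpace L]
    (X : H →L[ℂ] K) (e : H →L[ℂ] G) (f : K →L[ℂ] L) (he : DenseRange e) (hf : DenseRange f)
    (hX : ∀ k y, ‖inner ℂ (X k) y‖ ≤ ‖e k‖ * ‖f y‖) :
    ∃ γ : G →L[ℂ] L, ‖γ‖ ≤ 1 ∧ ∀ k y, inner ℂ (γ (e k)) (f y) = inner ℂ (X k) y := by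
  have h1 : ∀ k, ∃ z : L, ‖z‖ ≤ ‖e k‖ ∧ ∀ y, inner ℂ z (f y) = inner ℂ (X k) y := by
    intro k
    have hn : ∀ y, ‖(innerSL ℂ (X k)).toLinearMap y‖ ≤ ‖e k‖ * ‖f.toLinearMap y‖ := hX k
    refine ⟨(InnerProductSpace.toDual ℂ L).symm
      ((innerSL ℂ (X k)).toLinearMap.extendOfNorm f.toLinearMap), ?_, fun y => ?_⟩
    · rw [LinearIsometryEquiv.norm_map]
      exact LinearMap.opNorm_extendOfNorm_le hf (norm_nonneg _) hn
    · rw [InnerProductSpace.toDual_symm_apply]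
      exact LinearMap.extendOfNorm_eq (e := f.toLinearMap) hf ⟨_, hn⟩ y
  choose Z hZ1 hZ2 using h1
  have huniq : ∀ u v : L, (∀ y, inner ℂ u (f y) = inner ℂ v (f y)) → u = v := by
    intro u v h
    refine ext_inner_right ℂ fun w => ?_
    exact congrFun (hf.equalizer (by fun_prop) (by fun_prop) (funext h)) w
  let Zl : H →ₗ[ℂ] L :=
    { toFun := Z
      map_add' := fun a b => huniq _ _ fun y => by
        simp only [inner_add_left, hZ2, map_add]
      map_smul' := fun c a => huniq _ _ fun y => by
        simp only [inner_smul_left, hZ2, map_smul, RingHom.id_apply] }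
  have hn : ∀ k, ‖Zl k‖ ≤ 1 * ‖e.toLinearMap k‖ := fun k => by
    rw [one_mul]; exact hZ1 k
  refine ⟨Zl.extendOfNorm e.toLinearMap,
    LinearMap.opNorm_extendOfNorm_le he zero_le_one hn, fun k y => ?_⟩
  have : Zl.extendOfNorm e.toLinearMap (e k) = Zl k :=
    LinearMap.extendOfNorm_eq (e := e.toLinearMap) he ⟨_, hn⟩ k
  rw [this]
  exact hZ2 k y

/-- From an additive to a multiplicative bound. -/
theorem aux_amgm (r p q : ℝ) (hp : 0 ≤ p) (hq : 0 ≤ q)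
    (h : ∀ t : ℝ, 2 * (t * r) ≤ p ^ 2 + t ^ 2 * q ^ 2) : r ≤ q * p := by
  by_contra! hc
  have hr : 0 < r := lt_of_le_of_lt (mul_nonneg hq hp) hc
  rcases hq.eq_or_lt with h0 | h0
  · have := h ((p ^ 2 + 1) / r)
    rw [div_mul_cancel₀ _ hr.ne', ← h0] at this
    nlinarith [sq_nonneg p]
  · have := h (r / q ^ 2)
    have e1 : 2 * (r / q ^ 2 * r) = 2 * (r / q) ^ 2 := by field_simp
    have e2 : (r / q ^ 2) ^ 2 * q ^ 2 = (r / q) ^ 2 := by field_simp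
    rw [e1, e2] at this
    have h3 : p < r / q := by rw [lt_div_iff₀ h0]; linarith
    nlinarith

theorem aux_bound {H G K : Type*} [NormedAddCommGroup H] [InnerProductSpace ℂ H] [CompleteSpace H]
    [NormedAddCommGroup K] [InnerProductSpace ℂ K] [CompleteSpace K]
    [NormedAddCommGroup G] [InnerProductSpace ℂ G]
    (E : H →L[ℂ] K) (X : G →L[ℂ] K) (D : G →L[ℂ] G) (F : K →L[ℂ] K)
    (hF : ∀ y, ‖F y‖ ^ 2 = ‖y‖ ^ 2 - ‖ContinuousLinearMap.adjoint E y‖ ^ 2)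
    (h : ∀ a b, ‖E a + X b‖ ^ 2 ≤ ‖a‖ ^ 2 + ‖D b‖ ^ 2) (k : G) (y : K) :
    ‖inner ℂ (X k) y‖ ≤ ‖D k‖ * ‖F y‖ := by
  have base : ∀ k, 2 * (inner ℂ (X k) y).re ≤ ‖F y‖ ^ 2 + ‖D k‖ ^ 2 := by
    intro k
    have h1 := h (ContinuousLinearMap.adjoint E y) k
    have h2 := norm_sub_sq (𝕜 := ℂ) (E (ContinuousLinearMap.adjoint E y) + X k) y
    rw [inner_add_left, ← ContinuousLinearMap.adjoint_inner_right,
      map_add, inner_self_eq_norm_sq] at h2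
    have h3 : RCLike.re (inner ℂ (X k) y) = (inner ℂ (X k) y).re := rfl
    have h4 := sq_nonneg ‖E (ContinuousLinearMap.adjoint E y) + X k - y‖
    have h5 := hF y
    rw [h3] at h2
    linarith
  have re_bd : ∀ k, (inner ℂ (X k) y).re ≤ ‖D k‖ * ‖F y‖ := by
    intro k
    refine aux_amgm _ _ _ (norm_nonneg _) (norm_nonneg _) fun t => ?_
    have := base ((t : ℂ) • k)
    rw [map_smul, map_smul, inner_smul_left, norm_smul, mul_pow] at this
    simpa using this
  rcases eq_or_ne (inner ℂ (X k) y) 0 with h0 | h0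
  · rw [h0, norm_zero]; positivity
  · set w := inner ℂ (X k) y with hw
    have hn : (‖w‖ : ℂ) ≠ 0 := by simpa using h0
    have := re_bd ((w / ‖w‖) • k)
    rw [map_smul, map_smul, inner_smul_left, ← hw, norm_smul, norm_div] at this
    have e1 : (starRingEnd ℂ) (w / ‖w‖) * w = (‖w‖ : ℂ) := by
      rw [map_div₀, Complex.conj_ofReal, div_mul_eq_mul_div, div_eq_iff hn, mul_comm,
        Complex.mul_conj, Complex.normSq_eq_norm_sq]
      push_cast; ring
    rw [e1] at this
    simpa [h0] using this

theorem aux_row {H K : Type*} [NormedAddCommGroup H] [InnerProductSpace ℂ H] [CompleteSpace H]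
    [NormedAddCommGroup K] [InnerProductSpace ℂ K] [CompleteSpace K]
    (E : H →L[ℂ] K) (F : K →L[ℂ] K) (hFp : F.IsPositive)
    (hF : ∀ y, ‖F y‖ ^ 2 = ‖y‖ ^ 2 - ‖ContinuousLinearMap.adjoint E y‖ ^ 2) (a : H) (b : K) :
    ‖E a + F b‖ ^ 2 ≤ ‖a‖ ^ 2 + ‖b‖ ^ 2 := by
  set w := E a + F b with hw
  have h1 : inner ℂ w w = inner ℂ a (ContinuousLinearMap.adjoint E w) + inner ℂ b (F w) := by
    nth_rewrite 1 [hw]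
    rw [inner_add_left, ContinuousLinearMap.adjoint_inner_right, hFp.inner_left_eq_inner_right]
  have h2 := congrArg (RCLike.re : ℂ → ℝ) h1
  rw [inner_self_eq_norm_sq, map_add] at h2
  have h3 := norm_sub_sq (𝕜 := ℂ) a (ContinuousLinearMap.adjoint E w)
  have h4 := norm_sub_sq (𝕜 := ℂ) b (F w)
  nlinarith [sq_nonneg ‖a - ContinuousLinearMap.adjoint E w‖, sq_nonneg ‖b - F w‖, hF w]

open ContinuousLinearMap in
/-- The block tuple `E'_i = [[Ẽ_i, X̃_i], [0, Ã_i]]` is a row contraction iff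
`Ẽ` and `Ã` are row contractions and there is a contraction `γ : 𝒟_Ã → 𝒟_{*,Ẽ}` with
`𝐗̃ = D_{*,Ẽ} ∘ γ ∘ D_Ã`. -/
theorem statement5 {d : ℕ} {H_E H_A : Type*}
    [NormedAddCommGroup H_E] [InnerProductSpace ℂ H_E] [CompleteSpace H_E]
    [NormedAddCommGroup H_A] [InnerProductSpace ℂ H_A] [CompleteSpace H_A]
    (Et : Fin d → (H_E →L[ℂ] H_E)) (At : Fin d → (H_A →L[ℂ] H_A))
    (Xt : Fin d → (H_A →L[ℂ] H_E))
    (E' : Fin d → (WithLp 2 (H_E × H_A) →L[ℂ] WithLp 2 (H_E × H_A)))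
    (hE' : ∀ i, E' i = block2 (Et i) (Xt i) 0 (At i)) :
    ‖rowOp E'‖ ≤ 1 ↔
      ‖rowOp Et‖ ≤ 1 ∧ ‖rowOp At‖ ≤ 1 ∧
        ∃ (DsEt : H_E →L[ℂ] H_E) (DAt : Hd d H_A →L[ℂ] Hd d H_A),
          DsEt.IsPositive ∧ DsEt.comp DsEt = 1 - (rowOp Et).comp (adjoint (rowOp Et)) ∧
          DAt.IsPositive ∧ DAt.comp DAt = 1 - (adjoint (rowOp At)).comp (rowOp At) ∧
          ∃ γ : ↥(defectSpace DAt) →L[ℂ] ↥(defectSpace DsEt), ‖γ‖ ≤ 1 ∧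
            rowOp Xt =
              ((DsEt.comp ((defectSpace DsEt).subtypeL)).comp γ).comp (toDefect DAt) := by
  rw [aux_block_iff Et At Xt E' hE']
  constructor
  · intro h
    have hE : ‖rowOp Et‖ ≤ 1 := (aux_le_one_iff _).2 fun x => by simpa using h x 0
    have hA : ‖rowOp At‖ ≤ 1 := (aux_le_one_iff _).2 fun x => by
      have := h 0 x
      simp only [map_zero, zero_add, norm_zero] at this
      nlinarith [sq_nonneg ‖rowOp Xt x‖]
    refine ⟨hE, hA, ?_⟩
    obtain ⟨F, hF1, hF2⟩ := aux_exists_D (adjoint (rowOp Et)) (by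
      rwa [LinearIsometryEquiv.norm_map])
    obtain ⟨D, hD1, hD2⟩ := aux_exists_D (rowOp At) hA
    have hFn := aux_norm_sq_D _ F hF1 hF2
    have hDn := aux_norm_sq_D _ D hD1 hD2
    rw [adjoint_adjoint] at hF2
    refine ⟨F, D, hF1, hF2, hD1, hD2, ?_⟩
    have : CompleteSpace ↥(defectSpace F) :=
      (Submodule.isClosed_topologicalClosure _).completeSpace_coe
    obtain ⟨γ, hγ, hγ2⟩ := aux_factor (rowOp Xt) (toDefect D) (toDefect F) (aux_dense D)
      (aux_dense F) (fun k y => aux_bound (rowOp Et) (rowOp Xt) D F hFn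
        (fun a b => by have := h a b; have := hDn b; linarith) k y)
    refine ⟨γ, hγ, ?_⟩
    ext1 k
    refine ext_inner_right ℂ fun y => ?_
    rw [← hγ2 k y, Submodule.coe_inner]
    exact (hF1.inner_left_eq_inner_right _ _).symm
  · rintro ⟨hE, hA, F, D, hF1, hF2, hD1, hD2, γ, hγ, hX⟩ h k
    have hFn := aux_norm_sq_D (adjoint (rowOp Et)) F hF1 (by rw [adjoint_adjoint]; exact hF2)
    have hDn := aux_norm_sq_D _ D hD1 hD2 k
    have h1 := aux_row (rowOp Et) F hF1 hFn h (γ (toDefect D k) : H_E)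
    have h2 : ‖γ (toDefect D k)‖ ^ 2 ≤ ‖toDefect D k‖ ^ 2 := (aux_le_one_iff γ).1 hγ _
    have h3 : rowOp Xt k = F (γ (toDefect D k) : H_E) := by rw [hX]; rfl
    have h4 : ‖toDefect D k‖ = ‖D k‖ := rfl
    rw [Submodule.coe_norm, h4] at h2
    rw [h3]
    linarith
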